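/- arXiv:0901.1563 — 2 statements merged into one kernel-verified Lean document; each statement's English description precedes it below -/
import Mathlib

section
/- Let G be a finite simple graph, v a vertex, and C a set of vertices with v ∉ C such that every edge of G with an endpoint in C has its other endpoint in C ∪ {v} (v is a cut vertex separating C from the rest). If α(G[C ∪ {v}]) = α(G[C]), then α(G) = α(G[C]) + α(G[V \ (C ∪ {v})]). -/
/-- A set of vertices is independent if its elements are pairwise non-adjacent. -/
def IsIndepSet {V : Type*} (G : SimpleGraph V) (s : Set V) : Prop :=
  s.Pairwise fun a b => ¬ G.Adj a b

/-- A finset of vertices is a maximum independent set if it is independent and of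
maximum cardinality among independent sets. -/
def IsMaxIndepSet {V : Type*} (G : SimpleGraph V) (I : Finset V) : Prop :=
  IsIndepSet G ↑I ∧ ∀ J : Finset V, IsIndepSet G ↑J → J.card ≤ I.card

/-- The independence number of a graph: the maximum cardinality of an independent set. -/
noncomputable def indepNum {V : Type*} (G : SimpleGraph V) : ℕ :=
  sSup {n | ∃ s : Finset V, IsIndepSet G ↑s ∧ s.card = n}

lemma card_le_indepNum_aux {V : Type*} [Finite V] (G : SimpleGraph V) (s : Finset V)
    (hs : IsIndepSet G (s : Set V)) : s.card ≤ indepNum G := by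
  have := Fintype.ofFinite V
  refine le_csSup ⟨Fintype.card V, ?_⟩ ⟨s, hs, rfl⟩
  rintro n ⟨t, -, rfl⟩
  exact t.card_le_univ

lemma exists_indepNum_aux {V : Type*} [Finite V] (G : SimpleGraph V) :
    ∃ s : Finset V, IsIndepSet G (s : Set V) ∧ s.card = indepNum G := by
  have := Fintype.ofFinite V
  refine Nat.sSup_mem (s := {n | ∃ s : Finset V, IsIndepSet G (s : Set V) ∧ s.card = n})
    ⟨0, ∅, by simp [IsIndepSet], rfl⟩ ⟨Fintype.card V, ?_⟩
  rintro n ⟨t, -, rfl⟩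
  exact t.card_le_univ

lemma card_le_induce_aux {V : Type*} [Finite V] (G : SimpleGraph V) (S : Set V) (s : Finset V)
    (hs : IsIndepSet G (s : Set V)) (hS : ∀ x ∈ s, x ∈ S) :
    s.card ≤ indepNum (G.induce S) := by
  classical
  have h := card_le_indepNum_aux (G.induce S) (s.subtype (· ∈ S)) (by
    intro a ha b hb hab hadj
    exact hs (by simpa using ha) (by simpa using hb) (fun h => hab (Subtype.ext h)) hadj)
  rwa [Finset.card_subtype, Finset.filter_true_of_mem hS] at h

lemma exists_induce_aux {V : Type*} [Finite V] (G : SimpleGraph V) (S : Set V) :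
    ∃ s : Finset V, IsIndepSet G (s : Set V) ∧ (∀ x ∈ s, x ∈ S) ∧
      s.card = indepNum (G.induce S) := by
  obtain ⟨t, ht, hc⟩ := exists_indepNum_aux (G.induce S)
  refine ⟨t.map (Function.Embedding.subtype _), ?_, ?_, by rw [Finset.card_map, hc]⟩
  · intro a ha b hb hab hadj
    simp only [Finset.coe_map, Set.mem_image, Finset.mem_coe] at ha hb
    obtain ⟨a, ha, rfl⟩ := ha
    obtain ⟨b, hb, rfl⟩ := hb
    exact ht ha hb (fun h => hab (by rw [h])) hadj
  · intro x hx
    obtain ⟨y, -, rfl⟩ := Finset.mem_map.1 hx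
    exact y.2

/-- Articulation point rule: if v cuts off a component C and
α(G[C ∪ {v}]) = α(G[C]), then α(G) = α(G[C]) + α(G[V \ (C ∪ {v})]). -/
theorem articulation_point_equal {V : Type*} [Fintype V] [DecidableEq V]
    (G : SimpleGraph V) (v : V) (C : Set V) (hv : v ∉ C)
    (hsep : ∀ a b : V, G.Adj a b → a ∈ C → b ∈ C ∪ {v})
    (halpha : indepNum (G.induce (C ∪ {v})) = indepNum (G.induce C)) :
    indepNum G = indepNum (G.induce C) + indepNum (G.induce ((C ∪ {v})ᶜ)) := by
  classical
  apply le_antisymm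
  · obtain ⟨s, hs, hc⟩ := exists_indepNum_aux G
    rw [← halpha, ← hc, ← Finset.card_filter_add_card_filter_not (s := s) (· ∈ C ∪ {v})]
    refine add_le_add (card_le_induce_aux G _ _ ?_ ?_) (card_le_induce_aux G _ _ ?_ ?_)
    · exact hs.mono (Finset.coe_subset.2 (Finset.filter_subset _ _))
    · intro x hx
      exact (Finset.mem_filter.1 hx).2
    · exact hs.mono (Finset.coe_subset.2 (Finset.filter_subset _ _))
    · intro x hx
      exact (Finset.mem_filter.1 hx).2
  · obtain ⟨s, hs, hsC, hc⟩ := exists_induce_aux G C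
    obtain ⟨t, ht, htC, hd⟩ := exists_induce_aux G (C ∪ {v})ᶜ
    rw [← hc, ← hd, ← Finset.card_union_of_disjoint]
    · apply card_le_indepNum_aux
      intro a ha b hb hab hadj
      rcases Finset.mem_union.1 (Finset.mem_coe.1 ha) with ha | ha <;>
        rcases Finset.mem_union.1 (Finset.mem_coe.1 hb) with hb | hb
      · exact hs ha hb hab hadj
      · exact htC b hb (hsep a b hadj (hsC a ha))
      · exact htC a ha (hsep b a hadj.symm (hsC b hb))
      · exact ht ha hb hab hadj
    · rw [Finset.disjoint_left]
      intro x hx hx'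
      exact htC x hx' (Or.inl (hsC x hx))
end

section
/- Let G be a finite simple graph, v a vertex, and C a set of vertices with v ∉ C such that every edge of G with an endpoint in C has its other endpoint in C ∪ {v} (v is a cut vertex separating C from the rest). If α(G[C ∪ {v}]) = α(G[C]) + 1, then α(G) = α(G[C]) + α(G[V \ C]). -/
theorem apo_bdd {V : Type*} [Finite V] (G : SimpleGraph V) :
    BddAbove {n | ∃ s : Finset V, IsIndepSet G ↑s ∧ s.card = n} := by
  have := Fintype.ofFinite V
  refine ⟨Fintype.card V, ?_⟩
  rintro n ⟨s, -, rfl⟩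
  exact s.card_le_univ

theorem apo_le {V : Type*} [Finite V] (G : SimpleGraph V) (s : Finset V)
    (h : IsIndepSet G ↑s) : s.card ≤ indepNum G :=
  le_csSup (apo_bdd G) ⟨s, h, rfl⟩

theorem apo_exists {V : Type*} [Finite V] (G : SimpleGraph V) :
    ∃ s : Finset V, IsIndepSet G ↑s ∧ s.card = indepNum G :=
  Nat.sSup_mem (s := {n | ∃ s : Finset V, IsIndepSet G ↑s ∧ s.card = n})
    ⟨0, ∅, by simp [IsIndepSet], rfl⟩ (apo_bdd G)

theorem apo_induce_le {V : Type*} [Finite V] (G : SimpleGraph V) (S : Set V) (s : Finset V)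
    (hs : ∀ x ∈ s, x ∈ S) (h : IsIndepSet G ↑s) : s.card ≤ indepNum (G.induce S) := by
  classical
  have h1 : (s.subtype (· ∈ S)).card = s.card := by
    rw [Finset.card_subtype, Finset.filter_true_of_mem hs]
  rw [← h1]
  apply apo_le
  intro a ha b hb hab
  have ha' : (a : V) ∈ s := by simpa using ha
  have hb' : (b : V) ∈ s := by simpa using hb
  have := h ha' hb' (fun e => hab (Subtype.ext e))
  simpa using this

theorem apo_induce_exists {V : Type*} [Finite V] (G : SimpleGraph V) (S : Set V) :
    ∃ s : Finset V, (∀ x ∈ s, x ∈ S) ∧ IsIndepSet G ↑s ∧ s.card = indepNum (G.induce S) := by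
  classical
  obtain ⟨s, hs, hc⟩ := apo_exists (G.induce S)
  refine ⟨s.map (Function.Embedding.subtype _), ?_, ?_, by simpa using hc⟩
  · intro x hx
    obtain ⟨y, -, rfl⟩ := Finset.mem_map.1 hx
    exact y.2
  · intro a ha b hb hab
    obtain ⟨x, hx, rfl⟩ := Finset.mem_map.1 (Finset.mem_coe.1 ha)
    obtain ⟨y, hy, rfl⟩ := Finset.mem_map.1 (Finset.mem_coe.1 hb)
    have := hs hx hy (fun e => hab (by rw [e]))
    simpa using this

/-- Articulation point rule: if v cuts off a component C and
α(G[C ∪ {v}]) = α(G[C]) + 1, then α(G) = α(G[C]) + α(G[V \ C]). -/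
theorem articulation_point_plus_one {V : Type*} [Fintype V] [DecidableEq V]
    (G : SimpleGraph V) (v : V) (C : Set V) (hv : v ∉ C)
    (hsep : ∀ a b : V, G.Adj a b → a ∈ C → b ∈ C ∪ {v})
    (halpha : indepNum (G.induce (C ∪ {v})) = indepNum (G.induce C) + 1) :
    indepNum G = indepNum (G.induce C) + indepNum (G.induce (Cᶜ : Set V)) := by
  classical
  apply le_antisymm
  · obtain ⟨s, hs, hc⟩ := apo_exists G
    rw [← hc, ← Finset.card_filter_add_card_filter_not (s := s) (fun x => x ∈ C)]
    apply add_le_add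
    · exact apo_induce_le G C _ (fun x hx => (Finset.mem_filter.1 hx).2)
        (hs.mono (by intro x hx; exact (Finset.mem_filter.1 hx).1))
    · exact apo_induce_le G Cᶜ _ (fun x hx => (Finset.mem_filter.1 hx).2)
        (hs.mono (by intro x hx; exact (Finset.mem_filter.1 hx).1))
  · obtain ⟨A, hAS, hA, hAc⟩ := apo_induce_exists G (C ∪ {v})
    obtain ⟨B, hBS, hB, hBc⟩ := apo_induce_exists G Cᶜ
    have hvA : v ∈ A := by
      by_contra hvA
      have := apo_induce_le G C A (fun x hx => by
        rcases hAS x hx with h | h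
        · exact h
        · exact absurd (h ▸ hx) hvA) hA
      omega
    have hA' : ∀ x ∈ A.erase v, x ∈ C := by
      intro x hx
      rcases hAS x (Finset.mem_of_mem_erase hx) with h | h
      · exact h
      · exact absurd h (Finset.ne_of_mem_erase hx)
    have hcross : ∀ a ∈ A.erase v, ∀ b ∈ B, ¬ G.Adj a b := by
      intro a ha b hb hab
      rcases hsep a b hab (hA' a ha) with h | h
      · exact hBS b hb h
      · have h : b = v := h
        subst h
        exact hA (Finset.mem_of_mem_erase ha) hvA hab.ne hab
    have hdisj : Disjoint (A.erase v) B :=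
      Finset.disjoint_left.2 fun x hx hxB => hBS x hxB (hA' x hx)
    have hcard : (A.erase v ∪ B).card = indepNum (G.induce C) + indepNum (G.induce Cᶜ) := by
      rw [Finset.card_union_of_disjoint hdisj, Finset.card_erase_of_mem hvA]
      omega
    rw [← hcard]
    apply apo_le
    intro a ha b hb hab
    rcases Finset.mem_union.1 (Finset.mem_coe.1 ha) with ha | ha <;>
      rcases Finset.mem_union.1 (Finset.mem_coe.1 hb) with hb | hb
    · exact hA (Finset.mem_of_mem_erase ha) (Finset.mem_of_mem_erase hb) hab
    · exact hcross a ha b hb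
    · exact fun h => hcross b hb a ha h.symm
    · exact hB ha hb hab
end
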